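/- Let d ≥ 1 be an integer. There exists a constant C > 0, depending only on d, such that for every ε > 0 and every continuously differentiable function ψ : ℝ^d → ℝ with compact support, ‖ψ² ∗ p_ε − ψ²‖₁ ≤ C √ε ‖ψ‖₂ ‖∇ψ‖₂. -/

import Mathlib

open Real MeasureTheory

/-- The Gaussian heat kernel `p_ε(x) = (2πε)^{-d/2} exp(-|x|²/(2ε))` on `ℝ^d`. -/
noncomputable def heatKernel (d : ℕ) (ε : ℝ) (x : EuclideanSpace ℝ (Fin d)) : ℝ :=
  (2 * Real.pi * ε) ^ (-(d : ℝ) / 2) * Real.exp (-‖x‖ ^ 2 / (2 * ε))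

/-- Convolution of `f` with the Gaussian heat kernel `p_ε`. -/
noncomputable def heatConv (d : ℕ) (ε : ℝ) (f : EuclideanSpace ℝ (Fin d) → ℝ)
    (x : EuclideanSpace ℝ (Fin d)) : ℝ :=
  ∫ y, heatKernel d ε (x - y) * f y

/-- The `L^r` norm (w.r.t. Lebesgue measure) of `f : ℝ^d → ℝ`. -/
noncomputable def Lnorm (d : ℕ) (r : ℝ) (f : EuclideanSpace ℝ (Fin d) → ℝ) : ℝ :=
  (∫ x, |f x| ^ r) ^ (1 / r)

/-- The `L²` norm of the gradient of `ψ : ℝ^d → ℝ`. -/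
noncomputable def gradNorm2 (d : ℕ) (ψ : EuclideanSpace ℝ (Fin d) → ℝ) : ℝ :=
  (∫ x, ‖fderiv ℝ ψ x‖ ^ 2) ^ (1 / (2 : ℝ))

lemma heatKernel_nonneg (d : ℕ) {ε : ℝ} (hε : 0 < ε) (x : EuclideanSpace ℝ (Fin d)) :
    0 ≤ heatKernel d ε x := by
  unfold heatKernel
  positivity

lemma continuous_heatKernel (d : ℕ) (ε : ℝ) : Continuous (heatKernel d ε) := by
  unfold heatKernel
  fun_prop

lemma heatKernel_eq_exp (d : ℕ) (ε : ℝ) : heatKernel d ε = fun x =>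
    (2 * Real.pi * ε) ^ (-(d : ℝ) / 2) * Real.exp (-(1 / (2 * ε)) * ‖x‖ ^ 2) := by
  funext x
  unfold heatKernel
  congr 2
  ring

lemma integral_heatKernel (d : ℕ) {ε : ℝ} (hε : 0 < ε) : ∫ x, heatKernel d ε x = 1 := by
  rw [heatKernel_eq_exp, integral_const_mul,
    GaussianFourier.integral_rexp_neg_mul_sq_norm (by positivity : 0 < 1 / (2 * ε)),
    finrank_euclideanSpace_fin]
  have h : Real.pi / (1 / (2 * ε)) = 2 * Real.pi * ε := by field_simp
  rw [h, ← Real.rpow_add (by positivity)]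
  have h0 : -(d : ℝ) / 2 + d / 2 = 0 := by ring
  rw [h0, Real.rpow_zero]

lemma integrable_heatKernel (d : ℕ) {ε : ℝ} (hε : 0 < ε) : Integrable (heatKernel d ε) := by
  by_contra h
  have := integral_heatKernel d hε
  rw [integral_undef h] at this
  exact zero_ne_one this

lemma lintegral_enorm_heatKernel (d : ℕ) {ε : ℝ} (hε : 0 < ε) :
    ∫⁻ x, ‖heatKernel d ε x‖ₑ = 1 := by
  rw [← ofReal_integral_norm_eq_lintegral_enorm (integrable_heatKernel d hε)]
  simp_rw [Real.norm_of_nonneg (heatKernel_nonneg d hε _)]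
  simp [integral_heatKernel d hε]

/-- Doubling the variance of the heat kernel absorbs a factor `‖x‖`. -/
lemma heatKernel_mul_norm_le (d : ℕ) {ε : ℝ} (hε : 0 < ε) (x : EuclideanSpace ℝ (Fin d)) :
    heatKernel d ε x * ‖x‖ ≤ 2 ^ ((d : ℝ) / 2) * √ε * heatKernel d (2 * ε) x := by
  have hs : 0 < √ε := Real.sqrt_pos.2 hε
  set u := ‖x‖ ^ 2 / (4 * ε) with hu
  have hx : ‖x‖ ≤ √ε * Real.exp u := by
    have h1 : ‖x‖ ≤ √ε * (u + 1) := by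
      have hue : u = (‖x‖ / √ε) ^ 2 / 4 := by
        rw [hu, div_pow, Real.sq_sqrt hε.le]
        field_simp
      have : ‖x‖ / √ε ≤ u + 1 := by
        rw [hue]
        nlinarith [sq_nonneg (‖x‖ / √ε - 2)]
      rwa [div_le_iff₀' hs] at this
    exact h1.trans (mul_le_mul_of_nonneg_left (Real.add_one_le_exp u) hs.le)
  have hconst : (2 : ℝ) ^ ((d : ℝ) / 2) * (2 * Real.pi * (2 * ε)) ^ (-(d : ℝ) / 2)
      = (2 * Real.pi * ε) ^ (-(d : ℝ) / 2) := by
    have h : 2 * Real.pi * (2 * ε) = 2 * (2 * Real.pi * ε) := by ring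
    rw [h, Real.mul_rpow (by norm_num) (by positivity), ← mul_assoc,
      ← Real.rpow_add (by norm_num)]
    have h0 : (d : ℝ) / 2 + -(d : ℝ) / 2 = 0 := by ring
    rw [h0, Real.rpow_zero, one_mul]
  calc heatKernel d ε x * ‖x‖ ≤ heatKernel d ε x * (√ε * Real.exp u) :=
        mul_le_mul_of_nonneg_left hx (heatKernel_nonneg d hε x)
    _ = (2 * Real.pi * ε) ^ (-(d : ℝ) / 2) * √ε *
          (Real.exp (-‖x‖ ^ 2 / (2 * ε)) * Real.exp u) := by
        unfold heatKernel
        ring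
    _ = (2 * Real.pi * ε) ^ (-(d : ℝ) / 2) * √ε * Real.exp (-‖x‖ ^ 2 / (2 * (2 * ε))) := by
        rw [← Real.exp_add]
        congr 2
        rw [hu]
        field_simp
        ring
    _ = 2 ^ ((d : ℝ) / 2) * √ε * heatKernel d (2 * ε) x := by
        rw [← hconst]
        unfold heatKernel
        ring

lemma lintegral_heatKernel_mul_norm_le (d : ℕ) {ε : ℝ} (hε : 0 < ε) :
    ∫⁻ x, ‖heatKernel d ε x‖ₑ * ‖x‖ₑ ≤ ENNReal.ofReal (2 ^ ((d : ℝ) / 2) * √ε) := by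
  calc ∫⁻ x, ‖heatKernel d ε x‖ₑ * ‖x‖ₑ
      ≤ ∫⁻ x, ENNReal.ofReal (2 ^ ((d : ℝ) / 2) * √ε) * ‖heatKernel d (2 * ε) x‖ₑ := by
        refine lintegral_mono fun x => ?_
        have h2 : 0 < 2 * ε := by positivity
        rw [Real.enorm_of_nonneg (heatKernel_nonneg d hε x),
          Real.enorm_of_nonneg (heatKernel_nonneg d h2 x), ← ofReal_norm,
          ← ENNReal.ofReal_mul (heatKernel_nonneg d hε x),
          ← ENNReal.ofReal_mul (by positivity)]
        exact ENNReal.ofReal_le_ofReal (heatKernel_mul_norm_le d hε x)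
    _ = _ := by
        rw [lintegral_const_mul' _ _ ENNReal.ofReal_ne_top,
          lintegral_enorm_heatKernel d (by positivity), mul_one]

/-- Translating a `C¹` function by `z` moves it by at most `‖z‖ ‖∇f‖₁` in `L¹`. -/
lemma lintegral_enorm_comp_sub_sub_le {E : Type*} [NormedAddCommGroup E] [NormedSpace ℝ E]
    [MeasurableSpace E] [BorelSpace E] [SecondCountableTopology E] (μ : Measure E)
    [SFinite μ] [μ.IsAddRightInvariant] {f : E → ℝ} (hf : ContDiff ℝ 1 f) (z : E) :
    ∫⁻ x, ‖f (x - z) - f x‖ₑ ∂μ ≤ ‖z‖ₑ * ∫⁻ x, ‖fderiv ℝ f x‖ₑ ∂μ := by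
  have hf' : Continuous (fderiv ℝ f) := hf.continuous_fderiv one_ne_zero
  have hpt (x : E) : ‖f (x - z) - f x‖ₑ ≤
      ∫⁻ t in Set.Ioc (0 : ℝ) 1, ‖z‖ₑ * ‖fderiv ℝ f (x - t • z)‖ₑ := by
    have hd (t : ℝ) : HasDerivAt (fun t : ℝ => f (x - t • z))
        (fderiv ℝ f (x - t • z) (-z)) t := by
      have h1 : HasDerivAt (fun t : ℝ => x - t • z) (-z) t := by
        simpa using ((hasDerivAt_id t).smul_const z).const_sub x
      exact ((hf.differentiable one_ne_zero) (x - t • z)).hasFDerivAt.comp_hasDerivAt t h1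
    have hc : Continuous fun t : ℝ => fderiv ℝ f (x - t • z) (-z) := by fun_prop
    have hint := intervalIntegral.integral_eq_sub_of_hasDerivAt (a := 0) (b := 1)
      (fun t _ => hd t) (hc.intervalIntegrable 0 1)
    simp only [one_smul, zero_smul, sub_zero] at hint
    rw [← hint, intervalIntegral.integral_of_le zero_le_one]
    refine (enorm_integral_le_lintegral_enorm _).trans (lintegral_mono fun t => ?_)
    refine (ContinuousLinearMap.le_opENorm _ _).trans ?_
    rw [enorm_neg, mul_comm]
  have hmeas : Measurable (Function.uncurry fun (x : E) (t : ℝ) =>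
      ‖z‖ₑ * ‖fderiv ℝ f (x - t • z)‖ₑ) := by
    refine Measurable.const_mul ?_ _
    refine Continuous.measurable ?_
    fun_prop
  calc ∫⁻ x, ‖f (x - z) - f x‖ₑ ∂μ
      ≤ ∫⁻ x, (∫⁻ t in Set.Ioc (0 : ℝ) 1, ‖z‖ₑ * ‖fderiv ℝ f (x - t • z)‖ₑ) ∂μ :=
        lintegral_mono hpt
    _ = ∫⁻ t in Set.Ioc (0 : ℝ) 1, ∫⁻ x, ‖z‖ₑ * ‖fderiv ℝ f (x - t • z)‖ₑ ∂μ :=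
        lintegral_lintegral_swap hmeas.aemeasurable
    _ = ∫⁻ t in Set.Ioc (0 : ℝ) 1, ‖z‖ₑ * ∫⁻ x, ‖fderiv ℝ f x‖ₑ ∂μ := by
        refine lintegral_congr fun t => ?_
        rw [lintegral_const_mul' _ _ enorm_ne_top,
          lintegral_sub_right_eq_self (fun x => ‖fderiv ℝ f x‖ₑ)]
    _ = _ := by simp

lemma heatConv_sub_eq_integral (d : ℕ) {ε : ℝ} (hε : 0 < ε)
    {f : EuclideanSpace ℝ (Fin d) → ℝ} (hf : Continuous f) (hfc : HasCompactSupport f)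
    (x : EuclideanSpace ℝ (Fin d)) :
    heatConv d ε f x - f x = ∫ z, heatKernel d ε z * (f (x - z) - f x) := by
  have h1 : heatConv d ε f x = ∫ z, heatKernel d ε z * f (x - z) := by
    unfold heatConv
    rw [← integral_sub_left_eq_self (fun y => heatKernel d ε (x - y) * f y) volume x]
    simp
  have hi : Integrable fun z => heatKernel d ε z * f (x - z) := by
    refine Continuous.integrable_of_hasCompactSupport
      ((continuous_heatKernel d ε).mul (by fun_prop)) ?_
    exact (hfc.comp_homeomorph (Homeomorph.subLeft x)).mul_left
  simp_rw [mul_sub]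
  rw [integral_sub hi ((integrable_heatKernel d hε).mul_const _), integral_mul_const,
    integral_heatKernel d hε, one_mul, h1]

lemma lintegral_enorm_heatConv_sub_le (d : ℕ) {ε : ℝ} (hε : 0 < ε)
    {f : EuclideanSpace ℝ (Fin d) → ℝ} (hf : ContDiff ℝ 1 f) (hfc : HasCompactSupport f) :
    ∫⁻ x, ‖heatConv d ε f x - f x‖ₑ ≤
      ENNReal.ofReal (2 ^ ((d : ℝ) / 2) * √ε) * ∫⁻ x, ‖fderiv ℝ f x‖ₑ := by
  have hk := continuous_heatKernel d ε
  have hfcont := hf.continuous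
  have hmeas : Measurable (Function.uncurry fun x z : EuclideanSpace ℝ (Fin d) =>
      ‖heatKernel d ε z‖ₑ * ‖f (x - z) - f x‖ₑ) := by
    have h1 : Continuous fun p : EuclideanSpace ℝ (Fin d) × EuclideanSpace ℝ (Fin d) =>
      ‖heatKernel d ε p.2‖ₑ := by fun_prop
    have h2 : Continuous fun p : EuclideanSpace ℝ (Fin d) × EuclideanSpace ℝ (Fin d) =>
      ‖f (p.1 - p.2) - f p.1‖ₑ := by fun_prop
    exact h1.measurable.mul h2.measurable
  calc ∫⁻ x, ‖heatConv d ε f x - f x‖ₑ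
      ≤ ∫⁻ x, ∫⁻ z, ‖heatKernel d ε z‖ₑ * ‖f (x - z) - f x‖ₑ := by
        refine lintegral_mono fun x => ?_
        rw [heatConv_sub_eq_integral d hε hfcont hfc]
        refine (enorm_integral_le_lintegral_enorm _).trans_eq ?_
        simp_rw [enorm_mul]
    _ = ∫⁻ z, ∫⁻ x, ‖heatKernel d ε z‖ₑ * ‖f (x - z) - f x‖ₑ :=
        lintegral_lintegral_swap hmeas.aemeasurable
    _ ≤ ∫⁻ z, ‖heatKernel d ε z‖ₑ * ‖z‖ₑ * ∫⁻ x, ‖fderiv ℝ f x‖ₑ := by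
        refine lintegral_mono fun z => ?_
        rw [lintegral_const_mul' _ _ enorm_ne_top, mul_assoc]
        gcongr
        exact lintegral_enorm_comp_sub_sub_le volume hf z
    _ = (∫⁻ z, ‖heatKernel d ε z‖ₑ * ‖z‖ₑ) * ∫⁻ x, ‖fderiv ℝ f x‖ₑ := by
        refine lintegral_mul_const _ (Continuous.measurable ?_ |>.mul measurable_enorm)
        exact hk.enorm
    _ ≤ _ := by
        gcongr
        exact lintegral_heatKernel_mul_norm_le d hε

lemma integral_abs_heatConv_sub_le (d : ℕ) {ε : ℝ} (hε : 0 < ε)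
    {f : EuclideanSpace ℝ (Fin d) → ℝ} (hf : ContDiff ℝ 1 f) (hfc : HasCompactSupport f) :
    ∫ x, |heatConv d ε f x - f x| ≤ 2 ^ ((d : ℝ) / 2) * √ε * ∫ x, ‖fderiv ℝ f x‖ := by
  have hR : 0 ≤ ∫ x, ‖fderiv ℝ f x‖ := integral_nonneg fun _ => norm_nonneg _
  by_cases hi : Integrable fun x => |heatConv d ε f x - f x|
  · have hdi : Integrable (fderiv ℝ f) :=
      (hf.continuous_fderiv one_ne_zero).integrable_of_hasCompactSupport (hfc.fderiv ℝ)
    have h := lintegral_enorm_heatConv_sub_le d hε hf hfc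
    rw [← ofReal_integral_norm_eq_lintegral_enorm hdi, ← ENNReal.ofReal_mul (by positivity)] at h
    rw [← ENNReal.ofReal_le_ofReal_iff (by positivity),
      ofReal_integral_eq_lintegral_ofReal hi (ae_of_all _ fun _ => abs_nonneg _)]
    simpa only [← Real.norm_eq_abs, ofReal_norm] using h
  · rw [integral_undef hi]
    positivity

lemma integral_norm_fderiv_sq_le (d : ℕ) {ψ : EuclideanSpace ℝ (Fin d) → ℝ}
    (hψ : ContDiff ℝ 1 ψ) (hc : HasCompactSupport ψ) :
    ∫ x, ‖fderiv ℝ (fun y => ψ y ^ 2) x‖ ≤ 2 * (Lnorm d 2 ψ * gradNorm2 d ψ) := by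
  have hψ' : Continuous (fderiv ℝ ψ) := hψ.continuous_fderiv one_ne_zero
  have hpt (x : EuclideanSpace ℝ (Fin d)) :
      ‖fderiv ℝ (fun y => ψ y ^ 2) x‖ = 2 * (|ψ x| * ‖fderiv ℝ ψ x‖) := by
    have h := ((hψ.differentiable one_ne_zero) x).hasFDerivAt.pow 2
    rw [h.fderiv, norm_smul]
    simp [mul_assoc]
  have hm1 : MemLp (fun x => |ψ x|) (ENNReal.ofReal 2) :=
    hψ.continuous.abs.memLp_of_hasCompactSupport (hc.comp_left abs_zero)
  have hm2 : MemLp (fun x => ‖fderiv ℝ ψ x‖) (ENNReal.ofReal 2) :=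
    hψ'.norm.memLp_of_hasCompactSupport (hc.fderiv ℝ).norm
  have hh := integral_mul_le_Lp_mul_Lq_of_nonneg Real.HolderConjugate.two_two
    (ae_of_all _ fun x => abs_nonneg (ψ x)) (ae_of_all _ fun x => norm_nonneg (fderiv ℝ ψ x))
    hm1 hm2
  simp_rw [hpt]
  rw [integral_const_mul]
  unfold Lnorm gradNorm2
  simpa only [Real.rpow_ofNat] using mul_le_mul_of_nonneg_left hh zero_le_two

theorem smoothing_L1_bound (d : ℕ) (hd : 1 ≤ d) :
    ∃ C : ℝ, 0 < C ∧ ∀ ε : ℝ, 0 < ε → ∀ ψ : EuclideanSpace ℝ (Fin d) → ℝ,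
      ContDiff ℝ 1 ψ → HasCompactSupport ψ →
        Lnorm d 1 (fun x => heatConv d ε (fun y => ψ y ^ 2) x - ψ x ^ 2) ≤
          C * Real.sqrt ε * Lnorm d 2 ψ * gradNorm2 d ψ := by
  refine ⟨2 * 2 ^ ((d : ℝ) / 2), by positivity, fun ε hε ψ hψ hc => ?_⟩
  have hsq : HasCompactSupport fun y => ψ y ^ 2 :=
    hc.comp_left (g := fun t : ℝ => t ^ 2) (by norm_num)
  calc Lnorm d 1 (fun x => heatConv d ε (fun y => ψ y ^ 2) x - ψ x ^ 2)
      = ∫ x, |heatConv d ε (fun y => ψ y ^ 2) x - ψ x ^ 2| := by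
        simp [Lnorm]
    _ ≤ 2 ^ ((d : ℝ) / 2) * √ε * ∫ x, ‖fderiv ℝ (fun y => ψ y ^ 2) x‖ :=
        integral_abs_heatConv_sub_le d hε (hψ.pow 2) hsq
    _ ≤ 2 ^ ((d : ℝ) / 2) * √ε * (2 * (Lnorm d 2 ψ * gradNorm2 d ψ)) := by
        gcongr
        exact integral_norm_fderiv_sq_le d hψ hc
    _ = 2 * 2 ^ ((d : ℝ) / 2) * √ε * Lnorm d 2 ψ * gradNorm2 d ψ := by ring
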